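/- A loopless graph G is either the single-vertex graph K_1 or a loopless 2-edge-connected graph if and only if G is connected and G does not have, as a cc-minor, a tree with at least one edge. -/

import Mathlib

open scoped Classical

noncomputable section

/-- A finite multigraph with vertices and edge names drawn from `ℕ`.
Each edge name `e ∈ E` has a pair of (possibly equal) endpoints `ends e`. -/
structure MGraph where
  V : Finset ℕ
  E : Finset ℕ
  ends : ℕ → Sym2 ℕ
  ends_mem : ∀ e ∈ E, ∀ v ∈ ends e, v ∈ V

namespace MGraph

/-- Adjacency via some edge. -/
def Adj (G : MGraph) (u v : ℕ) : Prop := ∃ e ∈ G.E, G.ends e = s(u, v)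

/-- Reachability. -/
def Reach (G : MGraph) : ℕ → ℕ → Prop := Relation.ReflTransGen G.Adj

/-- A graph is connected if it has a vertex and all vertices are mutually reachable. -/
def Connected (G : MGraph) : Prop :=
  G.V.Nonempty ∧ ∀ u ∈ G.V, ∀ v ∈ G.V, G.Reach u v

/-- Delete a set of edges. -/
def deleteEdges (G : MGraph) (Z : Finset ℕ) : MGraph where
  V := G.V
  E := G.E \ Z
  ends := G.ends
  ends_mem := fun e he => G.ends_mem e (Finset.mem_sdiff.mp he).1

/-- A graph with at least two vertices is `k`-edge-connected if deleting any
set of fewer than `k` edges leaves it connected. -/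
def EdgeConnected (G : MGraph) (k : ℕ) : Prop :=
  2 ≤ G.V.card ∧ ∀ Z ⊆ G.E, Z.card < k → (G.deleteEdges Z).Connected

/-- A graph is loopless if no edge has equal endpoints. -/
def Loopless (G : MGraph) : Prop := ∀ e ∈ G.E, ¬ (G.ends e).IsDiag

/-- The set of vertices met by an edge set. -/
def vertsOf (G : MGraph) (C : Finset ℕ) : Finset ℕ :=
  G.V.filter (fun v => ∃ e ∈ C, v ∈ G.ends e)

/-- Degree of `v` in the edge set `C` (loops counted twice). -/
def degIn (G : MGraph) (C : Finset ℕ) (v : ℕ) : ℕ :=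
  ∑ e ∈ C, (if G.ends e = s(v, v) then 2 else if v ∈ G.ends e then 1 else 0)

/-- `C` is the edge set of a cycle of `G`: a nonempty connected edge set in which
every vertex met has degree exactly two (a loop and a pair of parallel edges are cycles). -/
def IsCycleSet (G : MGraph) (C : Finset ℕ) : Prop :=
  C.Nonempty ∧ C ⊆ G.E ∧
  (∀ v ∈ G.vertsOf C, G.degIn C v = 2) ∧
  ∀ u ∈ G.vertsOf C, ∀ v ∈ G.vertsOf C,
    Relation.ReflTransGen (fun a b => ∃ e ∈ C, G.ends e = s(a, b)) u v

/-- The vertex map identifying all vertices of `U` (within `G.V`) to a single one. -/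
def cmapOn (G : MGraph) (U : Finset ℕ) : ℕ → ℕ :=
  fun v => if v ∈ U ∩ G.V then sInf {w : ℕ | w ∈ U ∩ G.V} else v

/-- Contract the vertex set `U` to a single vertex, deleting the edges of `S` and all
newly created loops (edges with both ends in `U` that were not already loops), while
keeping pre-existing loops not in `S`. -/
def contractOn (G : MGraph) (U S : Finset ℕ) : MGraph where
  V := G.V.image (G.cmapOn U)
  E := G.E.filter (fun e => ¬ (∀ v ∈ G.ends e, v ∈ U) ∨ ((G.ends e).IsDiag ∧ e ∉ S))
  ends := fun e => (G.ends e).map (G.cmapOn U)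
  ends_mem := by
    intro e he v hv
    have he' : e ∈ G.E := (Finset.mem_filter.mp he).1
    rw [Sym2.mem_map] at hv
    obtain ⟨w, hw, rfl⟩ := hv
    have hwV : w ∈ G.V := G.ends_mem e he' w hw
    by_cases h : w ∈ U ∩ G.V
    · have hmem : sInf {x : ℕ | x ∈ U ∩ G.V} ∈ U ∩ G.V := Nat.sInf_mem ⟨w, h⟩
      refine Finset.mem_image.mpr ⟨sInf {x : ℕ | x ∈ U ∩ G.V},
        (Finset.mem_inter.mp hmem).2, ?_⟩
      simp [cmapOn, h, hmem]
    · exact Finset.mem_image.mpr ⟨w, hwV, by simp [cmapOn, h]⟩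

/-- Contract a cycle (given by its edge set), deleting all created loops. -/
def contractCycle (G : MGraph) (C : Finset ℕ) : MGraph :=
  G.contractOn (G.vertsOf C) C

/-- `H` is a cycle-contraction minor (cc-minor) of `G`: `H` is obtained from `G` by
a sequence of cycle contractions (each accompanied by contraction of created loops). -/
def CCMinor (G H : MGraph) : Prop :=
  Relation.ReflTransGen (fun A B => ∃ C, A.IsCycleSet C ∧ B = A.contractCycle C) G H

/-- Walks: a vertex list together with a matching edge list. -/
inductive IsWalk (G : MGraph) : List ℕ → List ℕ → Prop
  | nil {v : ℕ} (hv : v ∈ G.V) : IsWalk G [v] []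
  | cons {u v : ℕ} {e : ℕ} {vs es : List ℕ} (he : e ∈ G.E)
      (hends : G.ends e = s(u, v)) (hw : IsWalk G (v :: vs) es) :
      IsWalk G (u :: v :: vs) (e :: es)

/-- A path from `u` to `v`, given by its vertex list and edge list. -/
def IsPathBetween (G : MGraph) (u v : ℕ) (vs es : List ℕ) : Prop :=
  G.IsWalk vs es ∧ vs.Nodup ∧ vs.head? = some u ∧ vs.getLast? = some v

/-- `G` is `k`-connected: it has at least `k` vertices and any two distinct vertices are
joined by at least `k` pairwise internally disjoint paths. -/
def KConnected (G : MGraph) (k : ℕ) : Prop :=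
  k ≤ G.V.card ∧ ∀ u ∈ G.V, ∀ v ∈ G.V, u ≠ v →
    ∃ P : Fin k → List ℕ × List ℕ,
      (∀ i, G.IsPathBetween u v (P i).1 (P i).2) ∧
      ∀ i j, i ≠ j →
        (∀ x, x ∈ (P i).1 → x ∈ (P j).1 → x = u ∨ x = v) ∧
        (∀ e, e ∈ (P i).2 → e ∉ (P j).2)

/-- A simple graph: no loops and no parallel edges. -/
def Simple (G : MGraph) : Prop :=
  G.Loopless ∧ ∀ e ∈ G.E, ∀ f ∈ G.E, G.ends e = G.ends f → e = f

/-- Graph isomorphism. -/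
def Iso (G H : MGraph) : Prop :=
  ∃ φ ψ : ℕ → ℕ, Set.BijOn φ ↑G.V ↑H.V ∧ Set.BijOn ψ ↑G.E ↑H.E ∧
    ∀ e ∈ G.E, H.ends (ψ e) = (G.ends e).map φ

/-- The bond graph `B n`: two vertices joined by `n` parallel edges. -/
def IsBondGraph (H : MGraph) (n : ℕ) : Prop :=
  ∃ u v : ℕ, u ≠ v ∧ H.V = {u, v} ∧ H.E.card = n ∧ ∀ e ∈ H.E, H.ends e = s(u, v)

end MGraph

namespace MGraph

/-- `F` is a subgraph of `G`. -/
def IsSubgraph (F G : MGraph) : Prop :=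
  F.V ⊆ G.V ∧ F.E ⊆ G.E ∧ ∀ e ∈ F.E, F.ends e = G.ends e

end MGraph

/-- A forest: a graph with no cycles. -/
def MGraph.IsForest (H : MGraph) : Prop := ∀ C, ¬ H.IsCycleSet C

namespace MGraph

lemma endpoint_left_mem {G : MGraph} {e a b : ℕ} (he : e ∈ G.E) (hab : G.ends e = s(a, b)) :
    a ∈ G.V :=
  G.ends_mem e he a (by simp [hab])

lemma endpoint_right_mem {G : MGraph} {e a b : ℕ} (he : e ∈ G.E) (hab : G.ends e = s(a, b)) :
    b ∈ G.V :=
  G.ends_mem e he b (by simp [hab])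

lemma Adj.symm {G : MGraph} {u v : ℕ} (h : G.Adj u v) : G.Adj v u := by
  obtain ⟨e, he, h⟩ := h
  exact ⟨e, he, h.trans Sym2.eq_swap⟩

lemma Reach.symm {G : MGraph} {u v : ℕ} (h : G.Reach u v) : G.Reach v u := by
  induction h with
  | refl => exact .refl
  | tail _ hbc ih => exact .head hbc.symm ih

lemma endpoint_mult_eq (G : MGraph) {e a b : ℕ} (h : G.ends e = s(a, b)) (v : ℕ) :
    (if G.ends e = s(v, v) then 2 else if v ∈ G.ends e then 1 else 0) =
      (if v = a then 1 else 0) + (if v = b then 1 else 0) := by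
  rw [h]
  simp only [Sym2.eq_iff, Sym2.mem_iff]
  grind

lemma degIn_insert (G : MGraph) {C : Finset ℕ} {e a b : ℕ} (h : G.ends e = s(a, b))
    (he : e ∉ C) (v : ℕ) :
    G.degIn (insert e C) v =
      (if v = a then 1 else 0) + (if v = b then 1 else 0) + G.degIn C v := by
  unfold degIn
  rw [Finset.sum_insert he, endpoint_mult_eq G h]

/-- `P` is the edge set and `W` the vertex set of a path of `G` from the first vertex to the
second one. -/
inductive PathSet (G : MGraph) : Finset ℕ → Finset ℕ → ℕ → ℕ → Prop
  | refl (a : ℕ) : PathSet G ∅ {a} a a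
  | cons {P W : Finset ℕ} {a b c f : ℕ} (h : PathSet G P W a b) (hf : G.ends f = s(c, a))
      (hc : c ∉ W) : PathSet G (insert f P) (insert c W) c b

namespace PathSet

variable {G : MGraph} {P W : Finset ℕ} {a b : ℕ}

lemma left_mem (h : G.PathSet P W a b) : a ∈ W := by
  cases h <;> simp

lemma right_mem (h : G.PathSet P W a b) : b ∈ W := by
  induction h with
  | refl => simp
  | cons _ _ _ ih => exact Finset.mem_insert_of_mem ih

lemma ends_mem (h : G.PathSet P W a b) : ∀ f ∈ P, ∀ v ∈ G.ends f, v ∈ W := by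
  induction h with
  | refl => simp
  | cons h hf hc ih =>
    intro f hfP v hv
    rcases Finset.mem_insert.mp hfP with rfl | hfP
    · rw [hf, Sym2.mem_iff] at hv
      rcases hv with rfl | rfl
      · simp
      · exact Finset.mem_insert_of_mem h.left_mem
    · exact Finset.mem_insert_of_mem (ih f hfP v hv)

lemma degIn_add (h : G.PathSet P W a b) (v : ℕ) :
    G.degIn P v + (if v = a then 1 else 0) + (if v = b then 1 else 0) =
      if v ∈ W then 2 else 0 := by
  induction h with
  | refl => simp only [degIn, Finset.sum_empty, Finset.mem_singleton]; split_ifs <;> rfl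
  | @cons P W a b c f h hf hc ih =>
    have hfP : f ∉ P := fun hfP => hc (h.ends_mem f hfP c (by simp [hf]))
    rw [G.degIn_insert hf hfP]
    by_cases hvc : v = c
    · subst hvc
      simp only [hc, if_false] at ih
      simp only [Finset.mem_insert, true_or, if_true]
      omega
    · simp only [Finset.mem_insert, hvc, false_or, if_false]
      omega

lemma reach_right (h : G.PathSet P W a b) :
    ∀ v ∈ W, Relation.ReflTransGen (fun x y => ∃ e ∈ P, G.ends e = s(x, y)) v b := by
  induction h with
  | refl a => intro v hv; rw [Finset.mem_singleton.mp hv]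
  | @cons P W a b c f h hf hc ih =>
    have hmono : ∀ v ∈ W, Relation.ReflTransGen
        (fun x y => ∃ e ∈ insert f P, G.ends e = s(x, y)) v b := fun v hv =>
      Relation.ReflTransGen.mono
        (fun x y ⟨e, he, hxy⟩ => ⟨e, Finset.mem_insert_of_mem he, hxy⟩) _ _ (ih v hv)
    intro v hv
    rcases Finset.mem_insert.mp hv with rfl | hv
    · exact .head ⟨f, by simp, hf⟩ (hmono a h.left_mem)
    · exact hmono v hv

lemma exists_suffix (h : G.PathSet P W a b) :
    ∀ c ∈ W, ∃ P' ⊆ P, ∃ W', G.PathSet P' W' c b := by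
  induction h with
  | refl a =>
    intro c hc
    rw [Finset.mem_singleton.mp hc]
    exact ⟨∅, subset_rfl, _, .refl a⟩
  | cons h hf hc ih =>
    intro v hv
    rcases Finset.mem_insert.mp hv with rfl | hv
    · exact ⟨_, subset_rfl, _, h.cons hf hc⟩
    · obtain ⟨Q, hsub, Y, hpath⟩ := ih v hv
      exact ⟨Q, hsub.trans (Finset.subset_insert _ _), Y, hpath⟩

/-- Closing a path with an edge joining its ends gives a cycle. -/
lemma isCycleSet_insert (h : G.PathSet P W a b) (hP : P ⊆ G.E) {e : ℕ} (he : e ∈ G.E)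
    (heP : e ∉ P) (hab : G.ends e = s(a, b)) : G.IsCycleSet (insert e P) := by
  have hW : ∀ v ∈ G.vertsOf (insert e P), v ∈ W := by
    intro v hv
    obtain ⟨f, hf, hvf⟩ := (Finset.mem_filter.mp hv).2
    rcases Finset.mem_insert.mp hf with rfl | hf
    · rw [hab, Sym2.mem_iff] at hvf
      rcases hvf with rfl | rfl
      exacts [h.left_mem, h.right_mem]
    · exact h.ends_mem f hf v hvf
  have hreach : ∀ v ∈ W, Relation.ReflTransGen
      (fun x y => ∃ f ∈ insert e P, G.ends f = s(x, y)) v b := fun v hv =>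
    Relation.ReflTransGen.mono
      (fun x y ⟨f, hf, hxy⟩ => ⟨f, Finset.mem_insert_of_mem hf, hxy⟩) _ _ (h.reach_right v hv)
  refine ⟨Finset.insert_nonempty _ _, Finset.insert_subset he hP, fun v hv => ?_,
    fun u hu v hv => ?_⟩
  · have := h.degIn_add v
    rw [if_pos (hW v hv)] at this
    rw [G.degIn_insert hab heP]
    omega
  · refine (hreach u (hW u hu)).trans ?_
    have hsymm : Std.Symm fun x y => ∃ f ∈ insert e P, G.ends f = s(x, y) :=
      ⟨fun x y ⟨f, hf, hxy⟩ => ⟨f, hf, hxy.trans Sym2.eq_swap⟩⟩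
    exact Relation.ReflTransGen.stdSymm.symm _ _ (hreach v (hW v hv))

end PathSet

lemma Reach.exists_pathSet {G : MGraph} {a b : ℕ} (h : G.Reach a b) :
    ∃ P ⊆ G.E, ∃ W, G.PathSet P W a b := by
  induction h using Relation.ReflTransGen.head_induction_on with
  | refl => exact ⟨∅, by simp, _, .refl b⟩
  | @head c a hca _ ih =>
    obtain ⟨P, hP, W, h⟩ := ih
    obtain ⟨f, hf, hfe⟩ := hca
    by_cases hc : c ∈ W
    · obtain ⟨P', hP', W', h'⟩ := h.exists_suffix c hc
      exact ⟨P', hP'.trans hP, W', h'⟩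
    · exact ⟨_, Finset.insert_subset hf hP, _, h.cons hfe hc⟩

lemma PathSet.of_deleteEdges {G : MGraph} {Z P W : Finset ℕ} {a b : ℕ}
    (h : (G.deleteEdges Z).PathSet P W a b) : G.PathSet P W a b := by
  induction h with
  | refl a => exact .refl a
  | cons _ hf hc ih => exact ih.cons hf hc

lemma exists_isCycleSet_of_reach {G : MGraph} {e a b : ℕ} (he : e ∈ G.E)
    (hab : G.ends e = s(a, b)) (h : (G.deleteEdges {e}).Reach a b) : ∃ C, G.IsCycleSet C := by
  obtain ⟨P, hP, W, hPW⟩ := h.exists_pathSet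
  have hP' : ∀ f ∈ P, f ∈ G.E ∧ f ∉ ({e} : Finset ℕ) := fun f hf => Finset.mem_sdiff.mp (hP hf)
  exact ⟨_, hPW.of_deleteEdges.isCycleSet_insert (fun f hf => (hP' f hf).1) he
    (fun heP => (hP' e heP).2 (by simp)) hab⟩

lemma cmapOn_eq_of_mem {G : MGraph} {U : Finset ℕ} {u v : ℕ} (hu : u ∈ U) (huV : u ∈ G.V)
    (hv : v ∈ U) (hvV : v ∈ G.V) : G.cmapOn U u = G.cmapOn U v := by
  simp [cmapOn, hu, huV, hv, hvV]

lemma cmapOn_mem {G : MGraph} {U : Finset ℕ} {v : ℕ} (hv : v ∈ U) (hvV : v ∈ G.V) :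
    G.cmapOn U v ∈ U := by
  have h : v ∈ U ∩ G.V := Finset.mem_inter.mpr ⟨hv, hvV⟩
  have hmem : sInf {x : ℕ | x ∈ U ∩ G.V} ∈ U ∩ G.V := Nat.sInf_mem ⟨v, h⟩
  rw [cmapOn, if_pos h]
  exact (Finset.mem_inter.mp hmem).1

lemma contractOn_reach_map {G : MGraph} (U S Z : Finset ℕ) {u v : ℕ}
    (h : (G.deleteEdges Z).Reach u v) :
    ((G.contractOn U S).deleteEdges Z).Reach (G.cmapOn U u) (G.cmapOn U v) := by
  induction h with
  | refl => exact .refl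
  | @tail x y _ hxy ih =>
    obtain ⟨f, hf, hfe⟩ := hxy
    change G.ends f = s(x, y) at hfe
    obtain ⟨hfE, hfZ⟩ := Finset.mem_sdiff.mp hf
    by_cases hU : ∀ v ∈ G.ends f, v ∈ U
    · rwa [← cmapOn_eq_of_mem (hU x (by simp [hfe])) (endpoint_left_mem hfE hfe)
        (hU y (by simp [hfe])) (endpoint_right_mem hfE hfe)]
    · refine ih.tail ⟨f, ?_, ?_⟩
      · exact Finset.mem_sdiff.mpr ⟨Finset.mem_filter.mpr ⟨hfE, .inl hU⟩, hfZ⟩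
      · change (G.ends f).map _ = _
        rw [hfe, Sym2.map_mk]

lemma deleteEdges_empty (G : MGraph) : G.deleteEdges ∅ = G := by
  cases G
  simp [deleteEdges]

lemma Connected.contractOn_deleteEdges {G : MGraph} (U S : Finset ℕ) {Z : Finset ℕ}
    (h : (G.deleteEdges Z).Connected) : ((G.contractOn U S).deleteEdges Z).Connected := by
  refine ⟨Finset.Nonempty.image h.1 _, fun u hu v hv => ?_⟩
  obtain ⟨x, hx, rfl⟩ := Finset.mem_image.mp hu
  obtain ⟨y, hy, rfl⟩ := Finset.mem_image.mp hv
  exact contractOn_reach_map U S Z (h.2 x hx y hy)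

lemma Connected.contractCycle {G : MGraph} (h : G.Connected) (C : Finset ℕ) :
    (G.contractCycle C).Connected := by
  rw [← deleteEdges_empty G] at h
  have := h.contractOn_deleteEdges (G.vertsOf C) C
  rwa [deleteEdges_empty] at this

lemma contractCycle_E_subset (G : MGraph) (C : Finset ℕ) : (G.contractCycle C).E ⊆ G.E :=
  Finset.filter_subset _ _

lemma mem_vertsOf {G : MGraph} {C : Finset ℕ} (hC : C ⊆ G.E) {e v : ℕ} (he : e ∈ C)
    (hv : v ∈ G.ends e) : v ∈ G.vertsOf C :=
  Finset.mem_filter.mpr ⟨G.ends_mem e (hC he) v hv, e, he, hv⟩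

lemma IsCycleSet.contractCycle_E_ssubset {G : MGraph} {C : Finset ℕ} (hC : G.IsCycleSet C) :
    (G.contractCycle C).E ⊂ G.E := by
  obtain ⟨⟨e, he⟩, hCE, -⟩ := hC
  refine Finset.ssubset_iff_subset_ne.mpr ⟨contractCycle_E_subset G C, fun heq => ?_⟩
  have := hCE he
  rw [← heq] at this
  rcases (Finset.mem_filter.mp this).2 with h | h
  · exact h fun v hv => mem_vertsOf hCE he hv
  · exact h.2 he

lemma CCMinor.E_subset {G H : MGraph} (h : G.CCMinor H) : H.E ⊆ G.E := by
  induction h with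
  | refl => exact subset_rfl
  | tail _ hstep ih =>
    obtain ⟨C, -, rfl⟩ := hstep
    exact (contractCycle_E_subset _ C).trans ih

lemma CCMinor.connected_deleteEdges {G H : MGraph} (h : G.CCMinor H) {Z : Finset ℕ}
    (hG : (G.deleteEdges Z).Connected) : (H.deleteEdges Z).Connected := by
  induction h with
  | refl => exact hG
  | tail _ hstep ih =>
    obtain ⟨C, -, rfl⟩ := hstep
    exact ih.contractOn_deleteEdges _ C

/-- `e` is the only edge of `G` with exactly one end in `X`. -/
def IsBridgeCut (G : MGraph) (e : ℕ) (X : Set ℕ) : Prop :=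
  e ∈ G.E ∧ (∃ a b, G.ends e = s(a, b) ∧ a ∈ X ∧ b ∉ X) ∧
    ∀ f ∈ G.E, f ≠ e → ∀ u v, G.ends f = s(u, v) → (u ∈ X ↔ v ∈ X)

/-- A cycle meets every edge cut evenly, so it avoids bridges. -/
lemma IsBridgeCut.notMem_cycle {G : MGraph} {e : ℕ} {X : Set ℕ} (h : G.IsBridgeCut e X)
    {C : Finset ℕ} (hC : G.IsCycleSet C) : e ∉ C := by
  intro heC
  obtain ⟨-, hCE, hdeg, -⟩ := hC
  obtain ⟨-, ⟨a, b, hab, ha, hb⟩, hcut⟩ := h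
  set A := (G.vertsOf C).filter (· ∈ X) with hA
  have hmemA : ∀ f ∈ C, ∀ v ∈ G.ends f, (v ∈ A ↔ v ∈ X) := fun f hf v hv => by
    rw [hA, Finset.mem_filter]
    exact and_iff_right (mem_vertsOf hCE hf hv)
  have hcontrib : ∀ f u w, G.ends f = s(u, w) →
      ∑ v ∈ A, (if G.ends f = s(v, v) then 2 else if v ∈ G.ends f then 1 else 0) =
        (if u ∈ A then 1 else 0) + (if w ∈ A then 1 else 0) := fun f u w hf => by
    rw [Finset.sum_congr rfl fun v _ => endpoint_mult_eq G hf v, Finset.sum_add_distrib,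
      Finset.sum_ite_eq', Finset.sum_ite_eq']
  have heven : Even (∑ v ∈ A, G.degIn C v) :=
    Finset.even_sum _ fun v hv => by
      rw [hdeg v (Finset.mem_filter.mp hv).1]
      exact even_two
  unfold degIn at heven
  rw [Finset.sum_comm, ← Finset.add_sum_erase _ _ heC, hcontrib e a b hab,
    if_pos ((hmemA e heC a (by simp [hab])).mpr ha),
    if_neg (fun h => hb ((hmemA e heC b (by simp [hab])).mp h))] at heven
  have hrest : Even (∑ f ∈ C.erase e, ∑ v ∈ A,
      (if G.ends f = s(v, v) then 2 else if v ∈ G.ends f then 1 else 0)) := by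
    refine Finset.even_sum _ fun f hf => ?_
    obtain ⟨hfe, hfC⟩ := Finset.mem_erase.mp hf
    obtain ⟨u, w, huw⟩ : ∃ u w, G.ends f = s(u, w) := by
      induction hs : G.ends f with | _ u w => exact ⟨u, w, rfl⟩
    rw [hcontrib f u w huw]
    have h1 := hmemA f hfC u (by simp [huw])
    have h2 := hmemA f hfC w (by simp [huw])
    have h3 := hcut f (hCE hfC) hfe u w huw
    by_cases hu : u ∈ A
    · rw [if_pos hu, if_pos (h2.mpr (h3.mp (h1.mp hu)))]
      exact even_two
    · rw [if_neg hu, if_neg fun hw => hu (h1.mpr (h3.mpr (h2.mp hw)))]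
      exact Even.zero
  exact Nat.not_even_one ((Nat.even_add.mp heven).mpr hrest)

lemma IsBridgeCut.contractCycle {G : MGraph} {e : ℕ} {X : Set ℕ} (h : G.IsBridgeCut e X)
    {C : Finset ℕ} (hC : G.IsCycleSet C) : (G.contractCycle C).IsBridgeCut e X := by
  have heC := h.notMem_cycle hC
  obtain ⟨-, hCE, -, hconn⟩ := hC
  obtain ⟨heE, ⟨a, b, hab, ha, hb⟩, hcut⟩ := h
  have hside : ∀ u ∈ G.vertsOf C, ∀ v ∈ G.vertsOf C, (u ∈ X ↔ v ∈ X) := by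
    intro u hu v hv
    have h := hconn u hu v hv
    clear hv
    induction h with
    | refl => rfl
    | tail _ hyz ih =>
      obtain ⟨f, hf, hfe⟩ := hyz
      exact ih.trans (hcut f (hCE hf) (fun h => heC (h ▸ hf)) _ _ hfe)
  have hmap : ∀ v, (G.cmapOn (G.vertsOf C) v ∈ X ↔ v ∈ X) := by
    intro v
    by_cases hv : v ∈ G.vertsOf C
    · exact hside _ (cmapOn_mem hv (Finset.mem_filter.mp hv).1) _ hv
    · rw [cmapOn, if_neg fun h => hv (Finset.mem_inter.mp h).1]
  refine ⟨Finset.mem_filter.mpr ⟨heE, .inl fun hU => ?_⟩,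
    ⟨G.cmapOn (G.vertsOf C) a, G.cmapOn (G.vertsOf C) b, ?_, (hmap a).mpr ha,
      fun h => hb ((hmap b).mp h)⟩, fun f hf hfe u v huv => ?_⟩
  · exact hb ((hside a (hU a (by simp [hab])) b (hU b (by simp [hab]))).mp ha)
  · change (G.ends e).map _ = _
    rw [hab, Sym2.map_mk]
  · obtain ⟨x, y, hxy⟩ : ∃ x y, G.ends f = s(x, y) := by
      induction hs : G.ends f with | _ x y => exact ⟨x, y, rfl⟩
    have hiff := hcut f (contractCycle_E_subset G C hf) hfe x y hxy
    change (G.ends f).map (G.cmapOn (G.vertsOf C)) = _ at huv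
    rw [hxy, Sym2.map_mk] at huv
    rw [← hmap x, ← hmap y] at hiff
    rcases Sym2.eq_iff.mp huv with ⟨rfl, rfl⟩ | ⟨rfl, rfl⟩
    exacts [hiff, hiff.symm]

/-- A connected graph with a bridge has a tree with at least one edge as a cc-minor. -/
lemma IsBridgeCut.exists_tree_ccMinor {G : MGraph} {e : ℕ} {X : Set ℕ}
    (h : G.IsBridgeCut e X) (hG : G.Connected) :
    ∃ H, G.CCMinor H ∧ H.IsForest ∧ H.Connected ∧ H.E.Nonempty := by
  induction hn : G.E.card using Nat.strong_induction_on generalizing G with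
  | _ n ih =>
    by_cases hf : G.IsForest
    · exact ⟨G, .refl, hf, hG, e, h.1⟩
    · obtain ⟨C, hC⟩ := not_forall_not.mp hf
      obtain ⟨H, hH, hrest⟩ := ih _ (hn ▸ Finset.card_lt_card hC.contractCycle_E_ssubset)
        (h.contractCycle hC) (hG.contractCycle C) rfl
      exact ⟨H, .head ⟨C, hC, rfl⟩ hH, hrest⟩

/-- If deleting `e` disconnects its ends, then the component of one end is a cut with
only the edge `e`. -/
lemma isBridgeCut_of_not_reach {G : MGraph} {e a b : ℕ} (he : e ∈ G.E)
    (hab : G.ends e = s(a, b)) (h : ¬ (G.deleteEdges {e}).Reach a b) :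
    G.IsBridgeCut e {v | (G.deleteEdges {e}).Reach a v} := by
  refine ⟨he, ⟨a, b, hab, .refl, h⟩, fun f hf hfe u v huv => ?_⟩
  have hadj : (G.deleteEdges {e}).Adj u v :=
    ⟨f, Finset.mem_sdiff.mpr ⟨hf, by simpa using hfe⟩, huv⟩
  exact ⟨fun hu => Relation.ReflTransGen.tail hu hadj,
    fun hv => Relation.ReflTransGen.tail hv hadj.symm⟩

lemma Connected.edgeConnected_two {G : MGraph} (hG : G.Connected) (hcard : 2 ≤ G.V.card)
    (hbridge : ∀ e X, ¬ G.IsBridgeCut e X) : G.EdgeConnected 2 := by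
  refine ⟨hcard, fun Z _ hZ => ⟨hG.1, fun u hu v hv => ?_⟩⟩
  have h := hG.2 u hu v hv
  clear hv
  induction h with
  | refl => exact .refl
  | @tail x y _ hxy ih =>
    obtain ⟨f, hf, hfe⟩ := hxy
    by_cases hfZ : f ∈ Z
    · obtain rfl : Z = {f} :=
        (Finset.eq_of_subset_of_card_le (Finset.singleton_subset_iff.mpr hfZ)
          (by rw [Finset.card_singleton]; omega)).symm
      refine Relation.ReflTransGen.trans ih ?_
      by_contra hnot
      exact hbridge _ _ (isBridgeCut_of_not_reach hf hfe hnot)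
    · exact ih.tail ⟨f, Finset.mem_sdiff.mpr ⟨hf, hfZ⟩, hfe⟩

lemma Loopless.E_eq_empty {G : MGraph} (hG : G.Loopless) (hV : G.V.card = 1) : G.E = ∅ := by
  obtain ⟨w, hw⟩ := Finset.card_eq_one.mp hV
  refine Finset.eq_empty_of_forall_notMem fun e he => hG e he ?_
  have hends := G.ends_mem e he
  induction hs : G.ends e with
  | _ x y =>
    rw [hs, hw] at hends
    have hx := hends x (by simp)
    have hy := hends y (by simp)
    rw [Finset.mem_singleton] at hx hy
    simp [hx, hy]

end MGraph

/-- A loopless graph `G` is either the single-vertex graph `K₁` or 2-edge-connected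
if and only if `G` is connected and does not have, as a cc-minor, a tree with at
least one edge. -/
theorem statement_11 (G : MGraph) (hG : G.Loopless) :
    ((G.V.card = 1 ∧ G.E = ∅) ∨ G.EdgeConnected 2) ↔
      (G.Connected ∧
        ¬ ∃ H, G.CCMinor H ∧ H.IsForest ∧ H.Connected ∧ H.E.Nonempty) := by
  constructor
  · rintro (⟨hV, hE⟩ | ⟨-, hdel⟩)
    · obtain ⟨w, hw⟩ := Finset.card_eq_one.mp hV
      refine ⟨⟨by simp [hw], fun u hu v hv => ?_⟩, ?_⟩
      · rw [hw, Finset.mem_singleton] at hu hv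
        rw [hu, hv]
        exact .refl
      · rintro ⟨H, hH, -, -, e, he⟩
        have := hH.E_subset he
        simp [hE] at this
    · refine ⟨by simpa [MGraph.deleteEdges_empty] using hdel ∅ (by simp) (by simp), ?_⟩
      rintro ⟨H, hH, hforest, -, e, he⟩
      obtain ⟨a, b, hab⟩ : ∃ a b, H.ends e = s(a, b) := by
        induction hs : H.ends e with | _ a b => exact ⟨a, b, rfl⟩
      have hconn := hH.connected_deleteEdges
        (hdel {e} (Finset.singleton_subset_iff.mpr (hH.E_subset he)) (by simp))
      have ha : a ∈ H.V := MGraph.endpoint_left_mem he hab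
      have hb : b ∈ H.V := MGraph.endpoint_right_mem he hab
      obtain ⟨C, hC⟩ := MGraph.exists_isCycleSet_of_reach he hab (hconn.2 a ha b hb)
      exact hforest C hC
  · rintro ⟨hconn, hno⟩
    have hpos := hconn.1.card_pos
    by_cases hV : G.V.card = 1
    · exact .inl ⟨hV, hG.E_eq_empty hV⟩
    · exact .inr (hconn.edgeConnected_two (by omega)
        fun e X h => hno (h.exists_tree_ccMinor hconn))
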